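/- arXiv:2303.16521 — 2 statements merged into one kernel-verified Lean document; each statement's English description precedes it below -/
import Mathlib

section
/- Greedy step optimality criterion: let p : Fin K → ℝ be a strictly positive prior, μ_k ∈ ℝ^d and Σ_k ∈ ℝ^{d×d} positive definite for each cluster k, and suppose N−1 points z_1, …, z_{N−1} have already been assigned by y : Fin (N−1) → Fin K with counts n_k. Let z ∈ ℝ^d be the N-th point and for k ∈ Fin K let y⌢k denote the extension of y assigning z to cluster k. Then for any clusters k, k': Joint(y⌢k) ≥ Joint(y⌢k') if and only if d(z, μ_k, Σ_k) − log p(k) + log(n_k + 1) ≤ d(z, μ_{k'}, Σ_{k'}) − log p(k') + log(n_{k'} + 1), where Joint(y) = (∏_k p(k)^{n_k(y)}) · (|y|! / ∏_k n_k(y)!) · ∏_i φ(z_i; μ_{y(i)}, Σ_{y(i)}). Hence the cluster maximizing the conditional posterior of the N-th assignment is the cluster minimizing d(z, μ_k, Σ_k) − log p(k) + log(n_k + 1). -/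
open Real Matrix Finset

/-- The multivariate Gaussian density
`φ(z; μ, Σ) = exp(−½ (z−μ)ᵀ Σ⁻¹ (z−μ)) / √((2π)^d · det Σ)`. -/
noncomputable def gaussDensity {d : ℕ} (z μ : Fin d → ℝ) (S : Matrix (Fin d) (Fin d) ℝ) : ℝ :=
  Real.exp (-(1 / 2) * ((z - μ) ⬝ᵥ (S⁻¹ *ᵥ (z - μ)))) / Real.sqrt ((2 * Real.pi) ^ d * S.det)

/-- The Gaussian cost
`d(z, μ, Σ) = ½ (z−μ)ᵀ Σ⁻¹ (z−μ) + ½ log(det Σ) + (d/2) log(2π)`. -/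
noncomputable def gaussCost {d : ℕ} (z μ : Fin d → ℝ) (S : Matrix (Fin d) (Fin d) ℝ) : ℝ :=
  (1 / 2) * ((z - μ) ⬝ᵥ (S⁻¹ *ᵥ (z - μ))) + (1 / 2) * Real.log S.det +
    ((d : ℝ) / 2) * Real.log (2 * Real.pi)

/-- `counts y k` is the number of batch elements assigned to cluster `k` by `y`. -/
def counts {N K : ℕ} (y : Fin N → Fin K) (k : Fin K) : ℕ :=
  (Finset.univ.filter (fun i => y i = k)).card

/-- The joint probability of a batch of `N` points under assignment `y`:
`Joint(y) = (∏ₖ p(k)^{nₖ}) · (N! / ∏ₖ nₖ!) · ∏ᵢ φ(zᵢ; μ_{y i}, Σ_{y i})`. -/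
noncomputable def jointProb {N K d : ℕ} (p : Fin K → ℝ) (z : Fin N → Fin d → ℝ)
    (μ : Fin K → Fin d → ℝ) (S : Fin K → Matrix (Fin d) (Fin d) ℝ) (y : Fin N → Fin K) : ℝ :=
  (∏ k, p k ^ counts y k) *
    ((Nat.factorial N : ℝ) / ∏ k, (Nat.factorial (counts y k) : ℝ)) *
    ∏ i, gaussDensity (z i) (μ (y i)) (S (y i))

theorem gaussDensity_eq_exp_neg_gaussCost {d : ℕ} (z μ : Fin d → ℝ)
    {S : Matrix (Fin d) (Fin d) ℝ} (hS : 0 < S.det) :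
    gaussDensity z μ S = Real.exp (-gaussCost z μ S) := by
  have hpi : (0 : ℝ) < (2 * Real.pi) ^ d := by positivity
  have hsqrt : Real.sqrt ((2 * Real.pi) ^ d * S.det) =
      Real.exp ((1 / 2) * Real.log S.det + ((d : ℝ) / 2) * Real.log (2 * Real.pi)) := by
    rw [← Real.exp_log (Real.sqrt_pos.2 (mul_pos hpi hS)),
      Real.log_sqrt (mul_pos hpi hS).le, Real.log_mul hpi.ne' hS.ne', Real.log_pow]
    congr 1
    ring
  rw [gaussDensity, gaussCost, hsqrt, ← Real.exp_sub]
  congr 1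
  ring

theorem counts_snoc {N K : ℕ} (y : Fin N → Fin K) (k j : Fin K) :
    counts (Fin.snoc y k : Fin (N + 1) → Fin K) j = counts y j + if k = j then 1 else 0 := by
  simp only [counts, Finset.card_filter, Fin.sum_univ_castSucc, Fin.snoc_castSucc, Fin.snoc_last]

theorem prod_pow_counts_snoc {N K : ℕ} (p : Fin K → ℝ) (y : Fin N → Fin K) (k : Fin K) :
    ∏ j, p j ^ counts (Fin.snoc y k : Fin (N + 1) → Fin K) j = (∏ j, p j ^ counts y j) * p k := by
  simp only [counts_snoc, pow_add, Finset.prod_mul_distrib, pow_ite, pow_one, pow_zero,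
    Finset.prod_ite_eq, Finset.mem_univ, if_true]

theorem prod_factorial_counts_snoc {N K : ℕ} (y : Fin N → Fin K) (k : Fin K) :
    ∏ j, (Nat.factorial (counts (Fin.snoc y k : Fin (N + 1) → Fin K) j) : ℝ) =
      (∏ j, (Nat.factorial (counts y j) : ℝ)) * ((counts y k : ℝ) + 1) := by
  have h (j : Fin K) : (Nat.factorial (counts (Fin.snoc y k : Fin (N + 1) → Fin K) j) : ℝ) =
      (Nat.factorial (counts y j) : ℝ) * if k = j then (counts y j : ℝ) + 1 else 1 := by
    rw [counts_snoc]
    split_ifs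
    · rw [Nat.factorial_succ]
      push_cast
      ring
    · simp
  simp only [h, Finset.prod_mul_distrib, Finset.prod_ite_eq, Finset.mem_univ, if_true]

theorem jointProb_snoc {N K d : ℕ} (p : Fin K → ℝ) (z : Fin N → Fin d → ℝ)
    (μ : Fin K → Fin d → ℝ) (S : Fin K → Matrix (Fin d) (Fin d) ℝ) (y : Fin N → Fin K)
    (zN : Fin d → ℝ) (k : Fin K) :
    jointProb p (Fin.snoc z zN) μ S (Fin.snoc y k) =
      ((N : ℝ) + 1) * jointProb p z μ S y *
        (p k / ((counts y k : ℝ) + 1) * gaussDensity zN (μ k) (S k)) := by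
  simp only [jointProb, prod_pow_counts_snoc, prod_factorial_counts_snoc, Fin.prod_univ_castSucc,
    Fin.snoc_castSucc, Fin.snoc_last, Nat.factorial_succ, Nat.cast_mul, Nat.cast_succ]
  simp only [div_eq_mul_inv, mul_inv]
  ring

theorem jointProb_pos {N K d : ℕ} {p : Fin K → ℝ} (hp : ∀ k, 0 < p k) (z : Fin N → Fin d → ℝ)
    (μ : Fin K → Fin d → ℝ) {S : Fin K → Matrix (Fin d) (Fin d) ℝ} (hS : ∀ k, 0 < (S k).det)
    (y : Fin N → Fin K) : 0 < jointProb p z μ S y := by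
  refine mul_pos (mul_pos (Finset.prod_pos fun k _ => pow_pos (hp k) _) (div_pos ?_ ?_)) ?_
  · exact_mod_cast Nat.factorial_pos N
  · exact Finset.prod_pos fun k _ => by exact_mod_cast Nat.factorial_pos _
  · refine Finset.prod_pos fun i _ => ?_
    rw [gaussDensity_eq_exp_neg_gaussCost _ _ (hS _)]
    exact Real.exp_pos _

theorem prior_div_mul_gaussDensity_eq_exp {d : ℕ} {a : ℝ} (ha : 0 < a) (n : ℕ) (z μ : Fin d → ℝ)
    {S : Matrix (Fin d) (Fin d) ℝ} (hS : 0 < S.det) :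
    a / ((n : ℝ) + 1) * gaussDensity z μ S =
      Real.exp (-(gaussCost z μ S - Real.log a + Real.log ((n : ℝ) + 1))) := by
  have hn : (0 : ℝ) < (n : ℝ) + 1 := by positivity
  rw [gaussDensity_eq_exp_neg_gaussCost z μ hS, ← Real.exp_log (div_pos ha hn),
    Real.log_div ha.ne' hn.ne', ← Real.exp_add]
  congr 1
  ring

/-- Greedy step optimality criterion: if `N` points `z` have already been assigned by `y`
(with counts `nₖ = counts y k`) and `zN` is the next point, then extending `y` by assigning
`zN` to cluster `k` gives at least as large a joint probability as assigning it to `k'`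
iff `d(zN, μₖ, Σₖ) − log p(k) + log(nₖ + 1) ≤ d(zN, μₖ', Σₖ') − log p(k') + log(nₖ' + 1)`.
Hence the cluster maximizing the conditional posterior of the new assignment is the cluster
minimizing `d(zN, μₖ, Σₖ) − log p(k) + log(nₖ + 1)`. -/
theorem greedy_step_criterion {N K d : ℕ} (p : Fin K → ℝ) (hp : ∀ k, 0 < p k)
    (μ : Fin K → Fin d → ℝ) (S : Fin K → Matrix (Fin d) (Fin d) ℝ)
    (hS : ∀ k, (S k).PosDef) (z : Fin N → Fin d → ℝ) (y : Fin N → Fin K)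
    (zN : Fin d → ℝ) (k k' : Fin K) :
    jointProb p (Fin.snoc z zN) μ S (Fin.snoc y k') ≤
        jointProb p (Fin.snoc z zN) μ S (Fin.snoc y k) ↔
      gaussCost zN (μ k) (S k) - Real.log (p k) + Real.log ((counts y k : ℝ) + 1) ≤
        gaussCost zN (μ k') (S k') - Real.log (p k') + Real.log ((counts y k' : ℝ) + 1) := by
  have hdet (j : Fin K) : 0 < (S j).det := (hS j).det_pos
  have hC : 0 < ((N : ℝ) + 1) * jointProb p z μ S y :=
    mul_pos (by positivity) (jointProb_pos hp z μ hdet y)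
  rw [jointProb_snoc, jointProb_snoc, mul_le_mul_iff_right₀ hC,
    prior_div_mul_gaussDensity_eq_exp (hp k) _ _ _ (hdet k),
    prior_div_mul_gaussDensity_eq_exp (hp k') _ _ _ (hdet k'), Real.exp_le_exp, neg_le_neg_iff]
end

section
/- Quantitative form of Lemma 1: let x : Fin K → ℕ satisfy ∑_{j=1}^K x_j = N, and for each cluster k let H^{(k)} be the entropy of the empirical distribution obtained after assigning one additional point to cluster k. Then for any clusters k, k': | (H^{(k)} − H^{(k')}) − (1/(N+1)) · ( log(x_{k'} + 1) − log(x_k + 1) ) | < 1/(N+1). -/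
open Real Finset

/-- The counts after assigning one more point to cluster `k`:
`x'ⱼ = xⱼ + 1` if `j = k` and `x'ⱼ = xⱼ` otherwise. -/
def postCounts {K : ℕ} (x : Fin K → ℕ) (k : Fin K) (j : Fin K) : ℕ :=
  if j = k then x j + 1 else x j

/-- `H^{(k)}`: the Shannon entropy of the empirical distribution `(x'ⱼ/(N+1))ⱼ` of cluster
sizes after one more point has been assigned to cluster `k` (with the convention
`0·log 0 = 0`, which holds definitionally since `Real.log 0 = 0`). -/
noncomputable def postEnt {K : ℕ} (N : ℕ) (x : Fin K → ℕ) (k : Fin K) : ℝ :=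
  -∑ j, ((postCounts x k j : ℝ) / ((N : ℝ) + 1)) *
      Real.log ((postCounts x k j : ℝ) / ((N : ℝ) + 1))

theorem mul_log_succ_sub_log_mem_Ico (a : ℕ) :
    (a : ℝ) * (Real.log ((a : ℝ) + 1) - Real.log a) ∈ Set.Ico (0 : ℝ) 1 := by
  rcases Nat.eq_zero_or_pos a with rfl | ha
  · simp
  have ha' : (0 : ℝ) < a := by exact_mod_cast ha
  rw [← Real.log_div (by positivity) ha'.ne']
  have hdiv : ((a : ℝ) + 1) / a - 1 = 1 / a := by field_simp; ring
  have hinv : (0 : ℝ) < 1 / a := by positivity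
  constructor
  · exact mul_nonneg ha'.le (Real.log_nonneg (by linarith))
  · have hlog := Real.log_lt_sub_one_of_pos (x := ((a : ℝ) + 1) / a) (by positivity)
      (by linarith)
    calc (a : ℝ) * Real.log (((a : ℝ) + 1) / a) < a * (1 / a) := by
          rw [← hdiv]; gcongr
      _ = 1 := by field_simp

theorem div_mul_log_div (a : ℕ) {M : ℝ} (hM : 0 < M) :
    (a : ℝ) / M * Real.log ((a : ℝ) / M) = (a * Real.log a - a * Real.log M) / M := by
  rcases Nat.eq_zero_or_pos a with rfl | ha
  · simp
  have ha' : (0 : ℝ) < a := by exact_mod_cast ha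
  rw [Real.log_div ha'.ne' hM.ne']
  ring

theorem sum_postCounts {K : ℕ} (f : ℕ → ℝ) (x : Fin K → ℕ) (k : Fin K) :
    ∑ j, f (postCounts x k j) = ∑ j, f (x j) + (f (x k + 1) - f (x k)) := by
  have h : ∀ j, f (postCounts x k j) =
      f (x j) + if j = k then f (x k + 1) - f (x k) else 0 := by
    intro j
    by_cases hj : j = k
    · subst hj; simp [postCounts]
    · simp [postCounts, hj]
  simp [h, Finset.sum_add_distrib]

theorem postEnt_eq {K : ℕ} (N : ℕ) (x : Fin K → ℕ) (k : Fin K) :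
    postEnt N x k =
      -∑ j, (x j : ℝ) / ((N : ℝ) + 1) * Real.log ((x j : ℝ) / ((N : ℝ) + 1)) -
        (Real.log ((x k : ℝ) + 1) + x k * (Real.log ((x k : ℝ) + 1) - Real.log (x k)) -
          Real.log ((N : ℝ) + 1)) / ((N : ℝ) + 1) := by
  have hM : (0 : ℝ) < (N : ℝ) + 1 := by positivity
  rw [postEnt, sum_postCounts
    (fun c => (c : ℝ) / ((N : ℝ) + 1) * Real.log ((c : ℝ) / ((N : ℝ) + 1))),
    div_mul_log_div (x k + 1) hM, div_mul_log_div (x k) hM]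
  push_cast
  ring

/-- Quantitative form of Lemma 1:
`| (H^{(k)} − H^{(k')}) − (1/(N+1)) · (log(xₖ' + 1) − log(xₖ + 1)) | < 1/(N+1)`. -/
theorem abs_postEnt_diff_approx {K N : ℕ} (x : Fin K → ℕ) (hx : ∑ j, x j = N) (k k' : Fin K) :
    |(postEnt N x k - postEnt N x k') -
        (1 / ((N : ℝ) + 1)) *
          (Real.log ((x k' : ℝ) + 1) - Real.log ((x k : ℝ) + 1))| <
      1 / ((N : ℝ) + 1) := by
  have hM : (0 : ℝ) < (N : ℝ) + 1 := by positivity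
  obtain ⟨h₀, h₁⟩ := mul_log_succ_sub_log_mem_Ico (x k)
  obtain ⟨h₀', h₁'⟩ := mul_log_succ_sub_log_mem_Ico (x k')
  rw [postEnt_eq, postEnt_eq]
  set g := (x k : ℝ) * (Real.log ((x k : ℝ) + 1) - Real.log (x k))
  set g' := (x k' : ℝ) * (Real.log ((x k' : ℝ) + 1) - Real.log (x k'))
  calc _ = |(g' - g) / ((N : ℝ) + 1)| := by congr 1; ring
    _ = |g' - g| / ((N : ℝ) + 1) := by rw [abs_div, abs_of_pos hM]
    _ < 1 / ((N : ℝ) + 1) := by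
      gcongr
      rw [abs_lt]
      constructor <;> linarith
end
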